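/- arXiv:0801.2067 — 2 statements merged into one kernel-verified Lean document; each statement's English description precedes it below -/
import Mathlib

section
/- Let R be a commutative ring and U ⊆ R a multiplicative set. Then cot.D(U^{-1}R) ≤ cot.D(R); in particular, if R is n-perfect then the localization U^{-1}R is n-perfect. -/
open CategoryTheory Opposite

noncomputable section

universe u

variable (R : Type u) [CommRing R]

/-- `ExtVanish R M N n` : the `n`-th Ext group `Ext^n_R(M, N)` vanishes. -/
def ExtVanish (M N : ModuleCat.{u} R) (n : ℕ) : Prop :=
  Subsingleton (((Ext R (ModuleCat.{u} R) n).obj (op M)).obj N)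

/-- `TorVanish R M N n` : the `n`-th Tor group `Tor_n^R(M, N)` vanishes. -/
def TorVanish (M N : ModuleCat.{u} R) (n : ℕ) : Prop :=
  Subsingleton (((Tor (ModuleCat.{u} R) n).obj M).obj N)

/-- `pdLE R M n` : the projective dimension of `M` is at most `n`. -/
def pdLE (M : ModuleCat.{u} R) (n : ℕ) : Prop :=
  ∀ N : ModuleCat.{u} R, ExtVanish R M N (n + 1)

/-- `idLE R M n` : the injective dimension of `M` is at most `n`. -/
def idLE (M : ModuleCat.{u} R) (n : ℕ) : Prop :=
  ∀ N : ModuleCat.{u} R, ExtVanish R N M (n + 1)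

/-- `fdLE R M n` : the flat dimension of `M` is at most `n`. -/
def fdLE (M : ModuleCat.{u} R) (n : ℕ) : Prop :=
  ∀ N : ModuleCat.{u} R, TorVanish R M N (n + 1)

/-- `cdLE R M n` : the cotorsion dimension of `M` is at most `n`, i.e.
`Ext^{n+1}_R(F, M) = 0` for every flat `R`-module `F`. -/
def cdLE (M : ModuleCat.{u} R) (n : ℕ) : Prop :=
  ∀ F : ModuleCat.{u} R, Module.Flat R F → ExtVanish R F M (n + 1)

/-- The projective dimension of a module, as an element of `ℕ∞`. -/
def pd (M : ModuleCat.{u} R) : ℕ∞ := sInf ((↑) '' {n : ℕ | pdLE R M n})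

/-- The injective dimension of a module, as an element of `ℕ∞`. -/
def injd (M : ModuleCat.{u} R) : ℕ∞ := sInf ((↑) '' {n : ℕ | idLE R M n})

/-- The flat dimension of a module, as an element of `ℕ∞`. -/
def fd (M : ModuleCat.{u} R) : ℕ∞ := sInf ((↑) '' {n : ℕ | fdLE R M n})

/-- The cotorsion dimension of a module, as an element of `ℕ∞`. -/
def cd (M : ModuleCat.{u} R) : ℕ∞ := sInf ((↑) '' {n : ℕ | cdLE R M n})

/-- The global dimension of a ring. -/
def gldim : ℕ∞ := ⨆ M : ModuleCat.{u} R, pd R M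

/-- The weak global dimension of a ring. -/
def wdim : ℕ∞ := ⨆ M : ModuleCat.{u} R, fd R M

/-- The global cotorsion dimension of a ring: the supremum of the projective
dimensions of all flat modules. -/
def cotD : ℕ∞ := ⨆ (M : ModuleCat.{u} R) (_ : Module.Flat R M), pd R M

/-- The finitistic projective dimension of a ring. -/
def FPD : ℕ∞ := sSup {d : ℕ∞ | d ≠ ⊤ ∧ ∃ M : ModuleCat.{u} R, pd R M = d}

/-- The finitistic flat dimension of a ring. -/
def FFD : ℕ∞ := sSup {d : ℕ∞ | d ≠ ⊤ ∧ ∃ M : ModuleCat.{u} R, fd R M = d}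

/-- The finitistic injective dimension of a ring. -/
def FID : ℕ∞ := sSup {d : ℕ∞ | d ≠ ⊤ ∧ ∃ M : ModuleCat.{u} R, injd R M = d}

/-- The finitistic cotorsion dimension of a ring. -/
def FCD : ℕ∞ := sSup {d : ℕ∞ | d ≠ ⊤ ∧ ∃ M : ModuleCat.{u} R, cd R M = d}

/-- `R` is `n`-perfect if every flat `R`-module has projective dimension at most `n`. -/
def IsNPerfect (n : ℕ) : Prop :=
  ∀ M : ModuleCat.{u} R, Module.Flat R M → pd R M ≤ n

end

open CategoryTheory Opposite in
lemma extVanish_iff.{v} {R : Type v} [CommRing R] {M : ModuleCat.{v} R}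
    (P : ProjectiveResolution M) (N : ModuleCat.{v} R) (n : ℕ) :
    ExtVanish R M N (n + 1) ↔ ∀ f : P.complex.X (n + 1) ⟶ N,
      P.complex.d (n + 2) (n + 1) ≫ f = 0 → ∃ g, P.complex.d (n + 1) n ≫ g = f := by
  unfold ExtVanish
  rw [← ModuleCat.isZero_iff_subsingleton, (P.isoExt (n + 1) N).isZero_iff,
    ← HomologicalComplex.exactAt_iff_isZero_homology,
    HomologicalComplex.exactAt_iff' _ n (n + 1) (n + 2) (by simp) (by simp),
    ShortComplex.moduleCat_exact_iff]
  exact Iff.rfl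

open CategoryTheory Opposite in
lemma extVanish_iff_ext.{v} {R : Type v} [CommRing R] (M N : ModuleCat.{v} R) (n : ℕ) :
    ExtVanish R M N (n + 1) ↔ Subsingleton (Abelian.Ext.{v} M N (n + 1)) := by
  let P := projectiveResolution M
  rw [extVanish_iff P]
  constructor
  · intro h
    refine subsingleton_of_forall_eq 0 fun a => ?_
    obtain ⟨f, hf, rfl⟩ := P.extMk_surjective a (n + 2) rfl
    exact (P.extMk_eq_zero_iff f (n + 2) rfl hf n rfl).2 (h f hf)
  · intro h f hf
    exact (P.extMk_eq_zero_iff f (n + 2) rfl hf n rfl).1 (Subsingleton.elim _ _)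

open CategoryTheory Opposite in
lemma pdLE_iff.{v} {R : Type v} [CommRing R] (M : ModuleCat.{v} R) (n : ℕ) :
    pdLE R M n ↔ HasProjectiveDimensionLE M n := by
  unfold pdLE
  simp only [extVanish_iff_ext]
  exact ⟨fun h => hasProjectiveDimensionLT_of_enoughInjectives M (n + 1) h,
    fun h N => HasProjectiveDimensionLT.subsingleton M (n + 1) (n + 1) le_rfl N⟩

open CategoryTheory in
lemma exists_restrict.{v} {R : Type v} [CommRing R] (U : Submonoid R)
    (M : ModuleCat.{v} (Localization U)) (hM : Module.Flat (Localization U) M) :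
    ∃ M' : ModuleCat.{v} R, Module.Flat R M' ∧ pd (Localization U) M ≤ pd R M' := by
  letI : Module R M := Module.compHom M (algebraMap R (Localization U))
  haveI : IsScalarTower R (Localization U) M := IsScalarTower.of_algebraMap_smul fun _ _ => rfl
  haveI : Module.Flat R (Localization U) := IsLocalization.flat _ U
  refine ⟨ModuleCat.of R M, Module.Flat.trans R (Localization U) M, ?_⟩
  refine sInf_le_sInf (Set.image_mono fun n hn => ?_)
  simp only [Set.mem_setOf_eq, pdLE_iff] at hn ⊢
  have h1 := ModuleCat.localizedModule_hasProjectiveDimensionLE n U (ModuleCat.of R M)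
  haveI := isLocalizedModule_id U M (Localization U)
  let e : (ModuleCat.of R M).localizedModule U ≃ₗ[R] M :=
    IsLocalizedModule.linearEquiv U ((ModuleCat.of R M).localizedModuleMkLinearMap U)
      (LinearMap.id : M →ₗ[R] M)
  let e' := e.extendScalarsOfIsLocalization U (Localization U)
  exact hasProjectiveDimensionLT_of_iso e'.toModuleIso (n + 1)

/-- For a multiplicative set `U ⊆ R`, `cot.D (U⁻¹R) ≤ cot.D R`; in particular,
if `R` is `n`-perfect then so is the localization `U⁻¹R`. -/
theorem stmt_16 (R : Type u) [CommRing R] (U : Submonoid R) :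
    cotD (Localization U) ≤ cotD R ∧
      ∀ n : ℕ, IsNPerfect R n → IsNPerfect (Localization U) n := by
  refine ⟨?_, ?_⟩
  · refine iSup₂_le fun M hM => ?_
    obtain ⟨M', h1, h2⟩ := exists_restrict U M hM
    exact h2.trans (le_iSup₂_of_le M' h1 le_rfl)
  · intro n h M hM
    obtain ⟨M', h1, h2⟩ := exists_restrict U M hM
    exact h2.trans (h M' h1)
end

section
/- Let T = K + M be a domain where K is a field and M ≠ 0 is a maximal ideal of T, and let D be a proper subring of K with quotient field K. For R = D + M, cot.D(R) = max{cot.D(T), cot.D(D)}; i.e., R is n-perfect if and only if T and D are n-perfect. -/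
open CategoryTheory Opposite

namespace Stmt17

open TensorProduct

lemma extVanish_iff {R : Type u} [CommRing R] (X Y : ModuleCat.{u} R) (n : ℕ) :
    ExtVanish R X Y (n + 1) ↔ Subsingleton (Abelian.Ext.{u} X Y (n + 1)) := by
  let P := ProjectiveResolution.of X
  have h1 : ExtVanish R X Y (n + 1) ↔
      ∀ f : P.complex.X (n + 1) ⟶ Y, P.complex.d (n + 2) (n + 1) ≫ f = 0 →
        ∃ g : P.complex.X n ⟶ Y, P.complex.d (n + 1) n ≫ g = f := by
    unfold ExtVanish
    rw [← ModuleCat.isZero_iff_subsingleton, (P.isoExt (R := R) (n + 1) Y).isZero_iff,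
      ← HomologicalComplex.exactAt_iff_isZero_homology,
      HomologicalComplex.exactAt_iff' _ n (n + 1) (n + 2) (by simp) (by simp),
      ShortComplex.moduleCat_exact_iff]
    rfl
  rw [h1]
  constructor
  · intro h
    refine subsingleton_of_forall_eq 0 fun x => ?_
    obtain ⟨f, hf, rfl⟩ := P.extMk_surjective x (n + 2) rfl
    rw [P.extMk_eq_zero_iff _ _ _ _ n rfl]
    exact h f hf
  · intro h f hf
    rw [← P.extMk_eq_zero_iff _ (n + 2) rfl hf n rfl]
    exact Subsingleton.elim _ _

lemma pdLE_iff {R : Type u} [CommRing R] (X : ModuleCat.{u} R) (n : ℕ) :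
    pdLE R X n ↔ HasProjectiveDimensionLT X (n + 1) := by
  unfold pdLE
  simp only [extVanish_iff]
  constructor
  · intro h
    exact hasProjectiveDimensionLT_of_enoughInjectives X (n + 1) h
  · intro h Y
    exact HasProjectiveDimensionLT.subsingleton X (n + 1) (n + 1) le_rfl Y

lemma pd_le_iff {R : Type u} [CommRing R] (X : ModuleCat.{u} R) (n : ℕ) :
    pd R X ≤ n ↔ pdLE R X n := by
  unfold pd
  constructor
  · intro h
    by_cases he : {n : ℕ | pdLE R X n}.Nonempty
    · have := csInf_mem (he.image ((↑) : ℕ → ℕ∞))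
      obtain ⟨m, hm, hm'⟩ := this
      rw [← hm'] at h
      have hmn : m ≤ n := by exact_mod_cast h
      have := (pdLE_iff X m).1 hm
      exact (pdLE_iff X n).2 (hasProjectiveDimensionLT_of_ge X (m+1) (n+1) (by omega))
    · rw [Set.not_nonempty_iff_eq_empty] at he
      rw [he] at h
      simp at h
  · intro h
    exact sInf_le ⟨n, h, rfl⟩

lemma isNPerfect_iff (R : Type u) [CommRing R] (n : ℕ) :
    IsNPerfect R n ↔ ∀ X : ModuleCat.{u} R, Module.Flat R X →
      ∀ Y : ModuleCat.{u} R, Subsingleton (Abelian.Ext.{u} X Y (n + 1)) := by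
  unfold IsNPerfect
  simp only [pd_le_iff, pdLE, extVanish_iff]

lemma cotD_le_iff (R : Type u) [CommRing R] (n : ℕ) :
    cotD R ≤ n ↔ IsNPerfect R n := by
  unfold cotD IsNPerfect
  exact iSup_le_iff.trans (forall_congr' fun _ => iSup_le_iff)

section
variable {R : Type u} [CommRing R]

lemma shift_zero {S : ShortComplex (ModuleCat.{u} R)} (hS : S.ShortExact) [Projective S.X₂]
    (Y : ModuleCat.{u} R) :
    Subsingleton (Abelian.Ext.{u} S.X₃ Y 1) ↔
      ∀ f : S.X₁ →ₗ[R] Y, ∃ g : S.X₂ →ₗ[R] Y, g ∘ₗ S.f.hom = f := by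
  constructor
  · intro h f
    obtain ⟨x, hx⟩ := Abelian.Ext.contravariant_sequence_exact₁ hS Y
      (Abelian.Ext.mk₀ (ModuleCat.ofHom f)) (n₁ := 1) rfl (Subsingleton.elim _ _)
    obtain ⟨g, rfl⟩ := Abelian.Ext.homEquiv₀.symm.surjective x
    refine ⟨g.hom, ?_⟩
    simp only [Abelian.Ext.homEquiv₀_symm_apply, Abelian.Ext.mk₀_comp_mk₀] at hx
    have := Abelian.Ext.homEquiv₀.symm.injective (a₁ := S.f ≫ g) (a₂ := ModuleCat.ofHom f)
      (by simpa using hx)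
    have := congrArg ModuleCat.Hom.hom this
    simpa using this
  · intro h
    refine subsingleton_of_forall_eq 0 fun x => ?_
    obtain ⟨y, rfl⟩ := Abelian.Ext.contravariant_sequence_exact₃ hS Y x
      (Abelian.Ext.eq_zero_of_projective _) (n₀ := 0) rfl
    obtain ⟨f, rfl⟩ := Abelian.Ext.homEquiv₀.symm.surjective y
    obtain ⟨g, hg⟩ := h f.hom
    have : f = S.f ≫ ModuleCat.ofHom g := by
      ext1; simp [hg]
    rw [Abelian.Ext.homEquiv₀_symm_apply, this, ← Abelian.Ext.mk₀_comp_mk₀,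
      ← Abelian.Ext.comp_assoc _ _ _ (add_zero 1) (zero_add 0) (by omega)]
    simp

lemma shift_succ {S : ShortComplex (ModuleCat.{u} R)} (hS : S.ShortExact) [Projective S.X₂]
    (Y : ModuleCat.{u} R) (n : ℕ) :
    Subsingleton (Abelian.Ext.{u} S.X₃ Y (n + 2)) ↔
      Subsingleton (Abelian.Ext.{u} S.X₁ Y (n + 1)) := by
  constructor
  · intro h
    refine subsingleton_of_forall_eq 0 fun x => ?_
    obtain ⟨y, rfl⟩ := Abelian.Ext.contravariant_sequence_exact₁ hS Y x
      (n₁ := n + 2) (by omega) (Subsingleton.elim _ _)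
    rw [Abelian.Ext.eq_zero_of_projective y]
    simp
  · intro h
    refine subsingleton_of_forall_eq 0 fun x => ?_
    obtain ⟨y, rfl⟩ := Abelian.Ext.contravariant_sequence_exact₃ hS Y x
      (Abelian.Ext.eq_zero_of_projective _) (n₀ := n + 1) (by omega)
    rw [Subsingleton.elim y 0]
    simp

end

lemma flat_ker {R : Type u} [CommRing R] {P F : Type u} [AddCommGroup P] [Module R P]
    [AddCommGroup F] [Module R F] [Module.Flat R P] [Module.Flat R F] (π : P →ₗ[R] F)
    (hπ : Function.Surjective π) : Module.Flat R (LinearMap.ker π) := by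
  rw [Module.Flat.iff_rTensor_preserves_injective_linearMap]
  intro A B _ _ _ _ f hf
  have h1 := LinearMap.lTensor_injective_of_exact_of_flat π hπ (LinearMap.ker π).subtype
    (LinearMap.ker π).injective_subtype (LinearMap.exact_subtype_ker_map π) A
  have h2 := Module.Flat.rTensor_preserves_injective_linearMap (M := P) f hf
  have h3 : Function.Injective
      ((LinearMap.lTensor B (LinearMap.ker π).subtype) ∘ₗ (f.rTensor (LinearMap.ker π))) := by
    rw [LinearMap.lTensor_comp_rTensor, ← LinearMap.rTensor_comp_lTensor]
    exact h2.comp h1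
  exact Function.Injective.of_comp h3

lemma hom_baseChange {R : Type u} (S : Type u) [CommRing R] [CommRing S] [Algebra R S]
    (N : Type u) [AddCommGroup N] [Module R N] [Module S N] [IsScalarTower R S N]
    {Q P : Type u} [AddCommGroup Q] [Module R Q] [AddCommGroup P] [Module R P] (i : Q →ₗ[R] P) :
    (∀ f : Q →ₗ[R] N, ∃ g : P →ₗ[R] N, g ∘ₗ i = f) ↔
      ∀ f : S ⊗[R] Q →ₗ[S] N, ∃ g : S ⊗[R] P →ₗ[S] N, g ∘ₗ i.baseChange S = f := by
  constructor
  · intro h f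
    obtain ⟨g, hg⟩ := h (f.restrictScalars R ∘ₗ TensorProduct.mk R S Q 1)
    refine ⟨g.liftBaseChange S, ?_⟩
    ext x
    have := LinearMap.congr_fun hg x
    simpa using this
  · intro h f
    obtain ⟨g, hg⟩ := h (f.liftBaseChange S)
    refine ⟨g.restrictScalars R ∘ₗ TensorProduct.mk R S P 1, ?_⟩
    ext x
    have := LinearMap.congr_fun hg (1 ⊗ₜ x)
    simpa using this

lemma baseChange_ext {R S : Type u} [CommRing R] [CommRing S] [Algebra R S]
    (N : Type u) [AddCommGroup N] [Module R N] [Module S N] [IsScalarTower R S N] (n : ℕ) :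
    ∀ (F : Type u) [AddCommGroup F] [Module R F] [Module.Flat R F],
    (Subsingleton (Abelian.Ext.{u} (ModuleCat.of R F) (ModuleCat.of R N) (n + 1)) ↔
      Subsingleton (Abelian.Ext.{u} (ModuleCat.of S (S ⊗[R] F)) (ModuleCat.of S N) (n + 1))) := by
  have key : ∀ (F : Type u) [AddCommGroup F] [Module R F] [Module.Flat R F],
      ∃ (P : Type u) (_ : AddCommGroup P) (_ : Module R P) (_ : Module.Free R P)
        (π : P →ₗ[R] F), Function.Surjective π := by
    intro F _ _ _
    exact ⟨F →₀ R, inferInstance, inferInstance, inferInstance,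
      Finsupp.linearCombination R id, Finsupp.linearCombination_id_surjective R F⟩
  have sesS : ∀ (F : Type u) [AddCommGroup F] [Module R F] [Module.Flat R F]
      (P : Type u) [AddCommGroup P] [Module R P] (π : P →ₗ[R] F), Function.Surjective π →
      (ModuleCat.shortComplexOfCompEqZero ((LinearMap.ker π).subtype.baseChange S)
        (π.baseChange S) (by
          rw [← LinearMap.baseChange_comp, LinearMap.comp_ker_subtype, LinearMap.baseChange_zero])).ShortExact := by
    intro F _ _ _ P _ _ π hπ
    apply ModuleCat.shortComplex_shortExact
    · exact lTensor_exact S (LinearMap.exact_subtype_ker_map π) hπ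
    · exact LinearMap.lTensor_injective_of_exact_of_flat π hπ (LinearMap.ker π).subtype
        (LinearMap.ker π).injective_subtype (LinearMap.exact_subtype_ker_map π) S
    · exact LinearMap.lTensor_surjective S hπ
  induction n with
  | zero =>
    intro F _ _ _
    obtain ⟨P, _, _, _, π, hπ⟩ := key F
    have h1 := LinearMap.shortExact_shortComplexKer hπ
    have h2 := sesS F P π hπ
    have p1 : Projective (ModuleCat.of R P) :=
      ModuleCat.projective_of_categoryTheory_projective _
    have p2 : Projective (ModuleCat.of S (S ⊗[R] P)) :=
      ModuleCat.projective_of_categoryTheory_projective _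
    have e1 := @shift_zero _ _ _ h1 p1 (ModuleCat.of R N)
    have e2 := @shift_zero _ _ _ h2 p2 (ModuleCat.of S N)
    refine e1.trans (Iff.trans ?_ e2.symm)
    exact hom_baseChange S N (LinearMap.ker π).subtype
  | succ n ih =>
    intro F _ _ _
    obtain ⟨P, _, _, _, π, hπ⟩ := key F
    have h1 := LinearMap.shortExact_shortComplexKer hπ
    have h2 := sesS F P π hπ
    have p1 : Projective (ModuleCat.of R P) :=
      ModuleCat.projective_of_categoryTheory_projective _
    have p2 : Projective (ModuleCat.of S (S ⊗[R] P)) :=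
      ModuleCat.projective_of_categoryTheory_projective _
    have e1 := @shift_succ _ _ _ h1 p1 (ModuleCat.of R N) n
    have e2 := @shift_succ _ _ _ h2 p2 (ModuleCat.of S N) n
    have := flat_ker π hπ
    exact e1.trans ((ih (LinearMap.ker π)).trans e2.symm)

lemma ext_congr {R : Type u} [CommRing R] {X X' : Type u} [AddCommGroup X] [Module R X]
    [AddCommGroup X'] [Module R X'] (e : X ≃ₗ[R] X') (Y : ModuleCat.{u} R) (n : ℕ)
    (h : Subsingleton (Abelian.Ext.{u} (ModuleCat.of R X) Y n)) :
    Subsingleton (Abelian.Ext.{u} (ModuleCat.of R X') Y n) := by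
  refine subsingleton_of_forall_eq 0 fun x => ?_
  have h1 : (Abelian.Ext.mk₀ (ModuleCat.ofHom e.toLinearMap)).comp x (zero_add n) = 0 :=
    Subsingleton.elim _ _
  rw [← x.mk₀_id_comp, show 𝟙 (ModuleCat.of R X') =
    ModuleCat.ofHom e.symm.toLinearMap ≫ ModuleCat.ofHom e.toLinearMap by ext; simp,
    ← Abelian.Ext.mk₀_comp_mk₀, Abelian.Ext.comp_assoc_of_second_deg_zero, h1]
  simp

/-- localization -/
lemma perfect_loc {R T : Type u} [CommRing R] [CommRing T] [Algebra R T] (U : Submonoid R)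
    [IsLocalization U T] (n : ℕ) (h : IsNPerfect R n) : IsNPerfect T n := by
  rw [isNPerfect_iff] at h ⊢
  intro X hX Y
  let : Module R X := Module.compHom X (algebraMap R T)
  let : Module R Y := Module.compHom Y (algebraMap R T)
  have : IsScalarTower R T X := IsScalarTower.of_algebraMap_smul fun r x => rfl
  have : IsScalarTower R T Y := IsScalarTower.of_algebraMap_smul fun r x => rfl
  have : Module.Flat R T := IsLocalization.flat T U
  have : Module.Flat R X := Module.Flat.trans R T X
  have h1 := (baseChange_ext (R := R) (S := T) Y n X).1 (h (ModuleCat.of R X) ‹_› _)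
  exact ext_congr (IsLocalization.moduleLid U T X) Y (n + 1) h1

/-- retract -/
lemma perfect_retract {R D : Type u} [CommRing R] [CommRing D] [Algebra R D] [Algebra D R]
    (hD : ∀ d : D, algebraMap R D (algebraMap D R d) = d)
    (n : ℕ) (h : IsNPerfect R n) : IsNPerfect D n := by
  rw [isNPerfect_iff] at h ⊢
  intro X hX Y
  have : IsScalarTower D R D := IsScalarTower.of_algebraMap_eq fun d => (hD d).symm
  let : Module R Y := Module.compHom Y (algebraMap R D)
  have : IsScalarTower R D Y := IsScalarTower.of_algebraMap_smul fun r x => rfl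
  have h1 := (baseChange_ext (R := R) (S := D) Y n (R ⊗[D] X)).1
    (h (ModuleCat.of R (R ⊗[D] X)) inferInstance _)
  exact ext_congr ((AlgebraTensorModule.cancelBaseChange D R D D X).trans
    (TensorProduct.lid D X)) Y (n + 1) h1

lemma ext_killed {R D : Type u} [CommRing R] [CommRing D] [Algebra R D] [Algebra D R]
    (hD : ∀ d : D, algebraMap R D (algebraMap D R d) = d)
    (n : ℕ) (F : Type u) [AddCommGroup F] [Module R F] [Module.Flat R F]
    (hF : ∀ Y : ModuleCat.{u} D,
      Subsingleton (Abelian.Ext.{u} (ModuleCat.of D (D ⊗[R] F)) Y (n + 1)))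
    (N : Type u) [AddCommGroup N] [Module R N]
    (hN : ∀ r : R, algebraMap R D r = 0 → ∀ x : N, r • x = 0) :
    Subsingleton (Abelian.Ext.{u} (ModuleCat.of R F) (ModuleCat.of R N) (n + 1)) := by
  let : Module D N := Module.compHom N (algebraMap D R)
  have : IsScalarTower R D N := IsScalarTower.of_algebraMap_smul fun r x => by
    change algebraMap D R (algebraMap R D r) • x = r • x
    rw [← sub_eq_zero, ← sub_smul]
    exact hN _ (by simp [hD]) x
  exact (baseChange_ext (R := R) (S := D) N n F).2 (hF (ModuleCat.of D N))

lemma ext_mid {R : Type u} [CommRing R] {S : ShortComplex (ModuleCat.{u} R)} (hS : S.ShortExact)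
    (X : ModuleCat.{u} R) (n : ℕ) (h1 : Subsingleton (Abelian.Ext.{u} X S.X₁ n))
    (h3 : Subsingleton (Abelian.Ext.{u} X S.X₃ n)) :
    Subsingleton (Abelian.Ext.{u} X S.X₂ n) := by
  refine subsingleton_of_forall_eq 0 fun x => ?_
  obtain ⟨y, rfl⟩ := Abelian.Ext.covariant_sequence_exact₂ X hS x (Subsingleton.elim _ _)
  rw [Subsingleton.elim y 0]
  simp

lemma ext_right {R : Type u} [CommRing R] {S : ShortComplex (ModuleCat.{u} R)} (hS : S.ShortExact)
    (X : ModuleCat.{u} R) (n : ℕ) (h1 : Subsingleton (Abelian.Ext.{u} X S.X₁ (n + 1)))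
    (h2 : Subsingleton (Abelian.Ext.{u} X S.X₂ n)) :
    Subsingleton (Abelian.Ext.{u} X S.X₃ n) := by
  refine subsingleton_of_forall_eq 0 fun x => ?_
  obtain ⟨y, rfl⟩ := Abelian.Ext.covariant_sequence_exact₃ X hS x (n₁ := n + 1) rfl
    (Subsingleton.elim _ _)
  rw [Subsingleton.elim y 0]
  simp

lemma perfect_succ (R : Type u) [CommRing R] (n : ℕ) (h : IsNPerfect R n) :
    IsNPerfect R (n + 1) := fun X hX => (h X hX).trans (by norm_cast; omega)

lemma perfect_glue {R T D : Type u} [CommRing R] [CommRing T] [CommRing D] [Algebra R T]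
    [Algebra R D] [Algebra D R]
    (hD : ∀ d : D, algebraMap R D (algebraMap D R d) = d)
    (M : Type u) [AddCommGroup M] [Module R M] [Module T M] [IsScalarTower R T M]
    (j : M →ₗ[R] R) (hj : ∀ m m', j m • m' = j m' • m)
    (hj' : ∀ r, algebraMap R D r = 0 ↔ ∃ m, j m = r)
    (n : ℕ) (hT : IsNPerfect T n) (hDn : IsNPerfect D n) : IsNPerfect R n := by
  have hDn' := perfect_succ D n hDn
  rw [isNPerfect_iff] at hT hDn hDn' ⊢
  intro X hX N
  have hXT : Module.Flat T (T ⊗[R] X) := inferInstance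
  have hXD : Module.Flat D (D ⊗[R] X) := inferInstance
  let μ : M ⊗[R] N →ₗ[R] N := (TensorProduct.lid R N).toLinearMap ∘ₗ j.rTensor N
  have hμ : ∀ m (n : N), μ (m ⊗ₜ n) = j m • n := fun m n => by simp [μ]
  have hker : ∀ m (x : M ⊗[R] N), j m • x = m ⊗ₜ μ x := by
    intro m x
    induction x with
    | zero => simp
    | add x y hx hy => rw [smul_add, hx, hy, map_add, TensorProduct.tmul_add]
    | tmul m' y =>
      rw [hμ, TensorProduct.smul_tmul', hj, TensorProduct.smul_tmul]
  have : SMulCommClass R T M := ⟨fun r t m => by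
    rw [← algebraMap_smul T r, ← algebraMap_smul T r, smul_smul, smul_smul, mul_comm]⟩
  have : SMulCommClass T R M := SMulCommClass.symm _ _ _
  have e1 : Subsingleton (Abelian.Ext.{u} (ModuleCat.of R X)
      (ModuleCat.of R (M ⊗[R] N)) (n + 1)) :=
    (baseChange_ext (R := R) (S := T) (M ⊗[R] N) n X).2 (hT (ModuleCat.of T (T ⊗[R] X)) hXT _)
  have e2 : Subsingleton (Abelian.Ext.{u} (ModuleCat.of R X)
      (ModuleCat.of R (LinearMap.ker μ)) (n + 2)) := by
    refine ext_killed hD (n + 1) X (fun Y => hDn' _ hXD Y) _ fun r hr x => ?_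
    obtain ⟨m, rfl⟩ := (hj' r).1 hr
    ext
    rw [Submodule.coe_smul, hker, LinearMap.mem_ker.1 x.2]
    simp
  have e3 : Subsingleton (Abelian.Ext.{u} (ModuleCat.of R X)
      (ModuleCat.of R (N ⧸ LinearMap.range μ)) (n + 1)) := by
    refine ext_killed hD n X (fun Y => hDn _ hXD Y) _ fun r hr x => ?_
    obtain ⟨m, rfl⟩ := (hj' r).1 hr
    obtain ⟨y, rfl⟩ := Submodule.mkQ_surjective _ x
    rw [← map_smul, Submodule.mkQ_apply, Submodule.Quotient.mk_eq_zero]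
    exact ⟨m ⊗ₜ y, hμ _ _⟩
  have s1 : (ModuleCat.shortComplexOfCompEqZero (LinearMap.ker μ).subtype μ.rangeRestrict
      (by ext x; exact x.2)).ShortExact := by
    apply ModuleCat.shortComplex_shortExact
    · intro x
      constructor
      · intro hx
        exact ⟨⟨x, congrArg Subtype.val hx⟩, rfl⟩
      · rintro ⟨y, rfl⟩
        exact Subtype.ext y.2
    · exact Subtype.val_injective
    · exact μ.surjective_rangeRestrict
  have s2 : (ModuleCat.shortComplexOfCompEqZero (LinearMap.range μ).subtype
      (LinearMap.range μ).mkQ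
      (LinearMap.ext fun x => (Submodule.Quotient.mk_eq_zero _).2 x.2)).ShortExact := by
    apply ModuleCat.shortComplex_shortExact
    · exact LinearMap.exact_subtype_mkQ _
    · exact Subtype.val_injective
    · exact Submodule.mkQ_surjective _
  have e4 := ext_right s1 X (n + 1) e2 e1
  exact ext_mid s2 X (n + 1) e4 e3

end Stmt17

/-- For `T = K + M` a domain with `K` a field and `M ≠ 0` a maximal ideal, and
`D` a proper subring of `K` with quotient field `K`, the ring `R = D + M`
satisfies `cot.D R = max (cot.D T) (cot.D D)`; i.e. `R` is `n`-perfect iff `T`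
and `D` are `n`-perfect. -/
theorem stmt_17 (T : Type u) [CommRing T] [IsDomain T]
    (K : Subring T) (hK : IsField K)
    (M : Ideal T) (hMmax : M.IsMaximal) (hM0 : M ≠ ⊥)
    (hTKM : ∀ t : T, ∃ k ∈ K, t - k ∈ M)
    (hKM : ∀ k ∈ K, k ∈ M → k = 0)
    (D : Subring T) (hDK : D < K)
    (hqf : ∀ k ∈ K, ∃ a ∈ D, ∃ b ∈ D, b ≠ 0 ∧ k * b = a)
    (R : Subring T) (hR : ∀ x : T, x ∈ R ↔ ∃ d ∈ D, x - d ∈ M) :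
    cotD R = max (cotD T) (cotD D) ∧
      ∀ n : ℕ, (IsNPerfect R n ↔ IsNPerfect T n ∧ IsNPerfect D n) := by
  have hKD : ∀ d ∈ D, d ∈ K := fun d hd => hDK.le hd
  have hDR : ∀ d ∈ D, d ∈ R := fun d hd => (hR d).2 ⟨d, hd, by simp⟩
  have hMR : ∀ m ∈ M, m ∈ R := fun m hm => (hR m).2 ⟨0, D.zero_mem, by simpa using hm⟩
  have hex : ∀ x : R, ∃ d : D, (x : T) - d ∈ M := fun x => by
    obtain ⟨d, hd, h⟩ := (hR x).1 x.2
    exact ⟨⟨d, hd⟩, h⟩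
  have huniq : ∀ d d' : D, (d : T) - d' ∈ M → d = d' := fun d d' h => by
    have := hKM _ (K.sub_mem (hKD _ d.2) (hKD _ d'.2)) h
    exact Subtype.ext (sub_eq_zero.1 this)
  choose φ hφ using hex
  have hφu : ∀ (x : R) (d : D), (x : T) - d ∈ M → φ x = d := fun x d h => huniq _ _ (by
    have := M.sub_mem h (hφ x)
    simpa using this)
  let Φ : R →+* D :=
    { toFun := φ
      map_one' := hφu _ _ (by simp)
      map_zero' := hφu _ _ (by simp)
      map_add' := fun x y => hφu _ _ (by
        have := M.add_mem (hφ x) (hφ y)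
        convert this using 1
        push_cast
        ring)
      map_mul' := fun x y => hφu _ _ (by
        have := M.add_mem (M.mul_mem_right (y : T) (hφ x)) (M.mul_mem_left (φ x : T) (hφ y))
        convert this using 1
        push_cast
        ring) }
  let : Algebra R D := Φ.toAlgebra
  let : Algebra D R := (Subring.inclusion (fun d hd => hDR d hd : D ≤ R)).toAlgebra
  have hD : ∀ d : D, algebraMap R D (algebraMap D R d) = d := fun d =>
    hφu (algebraMap D R d) d (by
      change (d : T) - d ∈ M
      simp)
  let j : M →ₗ[R] R :=
    { toFun := fun m => ⟨m, hMR _ m.2⟩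
      map_add' := fun _ _ => rfl
      map_smul' := fun _ _ => rfl }
  have hj : ∀ m m', j m • m' = j m' • m := fun m m' => Subtype.ext (mul_comm (m : T) m')
  have hj' : ∀ r, algebraMap R D r = 0 ↔ ∃ m, j m = r := by
    intro r
    constructor
    · intro h
      have h2 := hφ r
      rw [show φ r = 0 from h] at h2
      exact ⟨⟨r, by simpa using h2⟩, rfl⟩
    · rintro ⟨m, rfl⟩
      exact hφu _ 0 (by simp [j])
  let U : Submonoid R :=
    { carrier := {x | (x : T) ∈ D ∧ x ≠ 0}
      one_mem' := ⟨D.one_mem, one_ne_zero⟩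
      mul_mem' := fun ha hb => ⟨D.mul_mem ha.1 hb.1, mul_ne_zero ha.2 hb.2⟩ }
  have hloc : IsLocalization U T := by
    refine ⟨?_, ?_, ?_⟩
    · rintro ⟨x, hx, hx0⟩
      have hne : (⟨x, hKD _ hx⟩ : K) ≠ 0 := fun h => hx0 (Subtype.ext (congrArg (Subtype.val : K → T) h))
      obtain ⟨y, hy⟩ := hK.mul_inv_cancel hne
      exact IsUnit.of_mul_eq_one (y : T) (congrArg Subtype.val hy)
    · intro t
      obtain ⟨k, hk, hkm⟩ := hTKM t
      obtain ⟨a, ha, b, hb, hb0, hab⟩ := hqf k hk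
      refine ⟨⟨⟨t * b, (hR _).2 ⟨a, ha, ?_⟩⟩, ⟨⟨b, hDR _ hb⟩, hb, ?_⟩⟩, rfl⟩
      · rw [← hab, ← sub_mul]
        exact M.mul_mem_right _ hkm
      · exact fun h => hb0 (congrArg Subtype.val h)
    · intro x y h
      exact ⟨1, by rw [Subtype.ext h]⟩
  have main : ∀ n : ℕ, (IsNPerfect R n ↔ IsNPerfect T n ∧ IsNPerfect D n) := fun n =>
    ⟨fun h => ⟨Stmt17.perfect_loc U n h, Stmt17.perfect_retract hD n h⟩,
      fun h => Stmt17.perfect_glue hD M j hj hj' n h.1 h.2⟩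
  refine ⟨?_, main⟩
  have hle : ∀ n : ℕ, cotD R ≤ n ↔ max (cotD T) (cotD D) ≤ n := fun n => by
    rw [max_le_iff, Stmt17.cotD_le_iff, Stmt17.cotD_le_iff, Stmt17.cotD_le_iff, main]
  apply le_antisymm
  · by_cases h : max (cotD T) (cotD D) = ⊤
    · rw [h]; exact le_top
    · lift max (cotD T) (cotD D) to ℕ using h with m hm
      exact (hle m).2 le_rfl
  · by_cases h : cotD R = ⊤
    · rw [h]; exact le_top
    · lift cotD R to ℕ using h with m hm
      exact (hle m).1 le_rfl
end
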